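/- arXiv:2604.11371 — 3 statements merged into one kernel-verified Lean document; each statement's English description precedes it below -/
import Mathlib

section
/- Let t₁ < t₂ be real numbers and R, L > 0. Let X, Y : [t₁, t₂] → ℝ³ be twice continuously differentiable with ∫_{t₁}^{t₂} ( ‖X''(s)‖ + ‖Y''(s)‖ ) ds ≤ R/4 and ‖X'(t₁) − Y'(t₁)‖ ≥ R. Then ‖X'(s) − Y'(s)‖ ≥ 3R/4 for all s ∈ [t₁, t₂], and ∫_{t₁}^{t₂} 1_{{‖X(s) − Y(s)‖ > L}} · ‖X(s) − Y(s)‖^{−2} ds ≤ 16/(R·L). -/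
open Set MeasureTheory intervalIntegral

/-- The increment of a `C¹` function is bounded by the integral of a majorant of its speed. -/
theorem norm_sub_le_integral_of_norm_deriv_le {E : Type*} [NormedAddCommGroup E]
    [NormedSpace ℝ E] [CompleteSpace E] {a b : ℝ} {V A : ℝ → E} {g : ℝ → ℝ}
    (hV : ∀ s ∈ Icc a b, HasDerivWithinAt V (A s) (Icc a b) s)
    (hA : ContinuousOn A (Icc a b)) (hg : ContinuousOn g (Icc a b))
    (hAg : ∀ s ∈ Icc a b, ‖A s‖ ≤ g s) {s : ℝ} (hs : s ∈ Icc a b) :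
    ‖V s - V a‖ ≤ ∫ r in a..b, g r := by
  have hsub : Icc a s ⊆ Icc a b := Icc_subset_Icc_right hs.2
  have hftc : ∫ r in a..s, A r = V s - V a := by
    refine integral_eq_sub_of_hasDerivAt_of_le hs.1
      (fun r hr => (hV r (hsub hr)).continuousWithinAt.mono hsub) (fun r hr => ?_)
      ((hA.mono hsub).intervalIntegrable_of_Icc hs.1)
    exact (hV r (hsub (Ioo_subset_Icc_self hr))).hasDerivAt
      (Icc_mem_nhds hr.1 (hr.2.trans_le hs.2))
  calc ‖V s - V a‖ ≤ ∫ r in a..s, g r := by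
        rw [← hftc]
        exact norm_integral_le_of_norm_le hs.1
          (Filter.Eventually.of_forall fun r hr => hAg r (hsub (Ioc_subset_Icc_self hr)))
          ((hg.mono hsub).intervalIntegrable_of_Icc hs.1)
    _ ≤ ∫ r in a..b, g r := by
        refine integral_mono_interval le_rfl hs.1 hs.2 ?_
          (hg.intervalIntegrable_of_Icc (hs.1.trans hs.2))
        filter_upwards [ae_restrict_mem measurableSet_Ioc] with r hr
        exact (norm_nonneg _).trans (hAg r (Ioc_subset_Icc_self hr))

/-- If `u' ≥ c > 0` on `[a, b]`, then `∫ₐᵇ (L² + u²)⁻¹ ≤ π / (c L)`. -/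
theorem integral_inv_sq_add_sq_le {a b c L : ℝ} (hab : a ≤ b) (hc : 0 < c) (hL : 0 < L)
    {u u' : ℝ → ℝ} (hu : ∀ s ∈ Icc a b, HasDerivWithinAt u (u' s) (Icc a b) s)
    (hu' : ∀ s ∈ Icc a b, c ≤ u' s) :
    ∫ s in a..b, (L ^ 2 + u s ^ 2)⁻¹ ≤ Real.pi / (c * L) := by
  have hcont : ContinuousOn u (Icc a b) := fun s hs => (hu s hs).continuousWithinAt
  have hbound : ∫ s in a..b, (L ^ 2 + u s ^ 2)⁻¹ ≤
      Real.arctan (u b / L) / (c * L) - Real.arctan (u a / L) / (c * L) := by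
    refine integral_le_sub_of_hasDeriv_right_of_le hab
      (g' := fun s => 1 / (1 + (u s / L) ^ 2) * (u' s / L) / (c * L))
      ((Real.continuous_arctan.comp_continuousOn (hcont.div_const L)).div_const _)
      (fun s hs => ?_) ?_ (fun s hs => ?_)
    · have h := (hu s (Ioo_subset_Icc_self hs)).hasDerivAt (Icc_mem_nhds hs.1 hs.2)
      exact ((h.div_const L).arctan.div_const (c * L)).hasDerivWithinAt
    · refine ContinuousOn.integrableOn_Icc (ContinuousOn.inv₀ (by fun_prop) fun s _ => ?_)
      positivity
    · have h := hu' s (Ioo_subset_Icc_self hs)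
      have heq : 1 / (1 + (u s / L) ^ 2) * (u' s / L) / (c * L) =
          (L ^ 2 + u s ^ 2)⁻¹ * (u' s / c) := by
        have : L ^ 2 + u s ^ 2 ≠ 0 := by positivity
        field_simp
      rw [heq]
      exact le_mul_of_one_le_right (by positivity) ((one_le_div hc).2 h)
  refine hbound.trans ?_
  rw [← sub_div]
  gcongr
  linarith [Real.arctan_lt_pi_div_two (u b / L), Real.neg_pi_div_two_lt_arctan (u a / L)]

/-- **Two-trajectory lemma.**
Let `X, Y : [t₁,t₂] → ℝ³` be twice continuously differentiable with
`∫_{t₁}^{t₂} (‖X''‖ + ‖Y''‖) ≤ R/4` and `‖X'(t₁) − Y'(t₁)‖ ≥ R`. Then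
`‖X'(s) − Y'(s)‖ ≥ 3R/4` on `[t₁,t₂]` and
`∫_{t₁}^{t₂} 1_{‖X−Y‖ > L}·‖X − Y‖^{−2} ≤ 16/(R·L)`. -/
theorem stmt16 (t₁ t₂ : ℝ) (h12 : t₁ < t₂) (R L : ℝ) (hR : 0 < R) (hL : 0 < L)
    (X X' X'' Y Y' Y'' : ℝ → EuclideanSpace ℝ (Fin 3))
    (hX' : ∀ s ∈ Set.Icc t₁ t₂, HasDerivWithinAt X (X' s) (Set.Icc t₁ t₂) s)
    (hX'' : ∀ s ∈ Set.Icc t₁ t₂, HasDerivWithinAt X' (X'' s) (Set.Icc t₁ t₂) s)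
    (hX''c : ContinuousOn X'' (Set.Icc t₁ t₂))
    (hY' : ∀ s ∈ Set.Icc t₁ t₂, HasDerivWithinAt Y (Y' s) (Set.Icc t₁ t₂) s)
    (hY'' : ∀ s ∈ Set.Icc t₁ t₂, HasDerivWithinAt Y' (Y'' s) (Set.Icc t₁ t₂) s)
    (hY''c : ContinuousOn Y'' (Set.Icc t₁ t₂))
    (hacc : (∫ s in t₁..t₂, (‖X'' s‖ + ‖Y'' s‖)) ≤ R / 4)
    (hvel : R ≤ ‖X' t₁ - Y' t₁‖) :
    (∀ s ∈ Set.Icc t₁ t₂, 3 * R / 4 ≤ ‖X' s - Y' s‖) ∧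
    (∫ s in t₁..t₂,
        Set.indicator {s | L < ‖X s - Y s‖} (fun s => (‖X s - Y s‖ ^ 2)⁻¹) s) ≤
      16 / (R * L) := by
  have hacc_bound : ∀ s ∈ Icc t₁ t₂, ‖(X' s - Y' s) - (X' t₁ - Y' t₁)‖ ≤ R / 4 := fun s hs =>
    (norm_sub_le_integral_of_norm_deriv_le (V := fun r => X' r - Y' r)
      (fun r hr => (hX'' r hr).sub (hY'' r hr)) (hX''c.sub hY''c) (hX''c.norm.add hY''c.norm)
      (fun r _ => norm_sub_le _ _) hs).trans hacc
  refine ⟨fun s hs => ?_, ?_⟩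
  · have h := norm_sub_norm_le (X' t₁ - Y' t₁) (X' s - Y' s)
    rw [norm_sub_rev (X' t₁ - Y' t₁) (X' s - Y' s)] at h
    linarith [hacc_bound s hs]
  set v := X' t₁ - Y' t₁
  have hvpos : 0 < ‖v‖ := hR.trans_le hvel
  set e := ‖v‖⁻¹ • v with he
  have he1 : ‖e‖ = 1 := by rw [he, norm_smul, norm_inv, norm_norm, inv_mul_cancel₀ hvpos.ne']
  have hev : inner ℝ e v = ‖v‖ := by
    rw [he, real_inner_smul_left, real_inner_self_eq_norm_sq]
    field_simp
  set u : ℝ → ℝ := fun s => inner ℝ e (X s - Y s)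
  have hderiv : ∀ s ∈ Icc t₁ t₂,
      HasDerivWithinAt u (inner ℝ e (X' s - Y' s)) (Icc t₁ t₂) s := fun s hs =>
    (innerSL ℝ e).hasFDerivAt.comp_hasDerivWithinAt s ((hX' s hs).sub (hY' s hs))
  have hspeed : ∀ s ∈ Icc t₁ t₂, 3 * R / 4 ≤ inner ℝ e (X' s - Y' s) := fun s hs => by
    have h := (abs_le.1 (abs_real_inner_le_norm e ((X' s - Y' s) - v))).1
    rw [he1, one_mul, inner_sub_right, hev] at h
    linarith [hacc_bound s hs]
  have hcont : ContinuousOn u (Icc t₁ t₂) := fun s hs => (hderiv s hs).continuousWithinAt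
  calc _ ≤ ∫ s in t₁..t₂, 2 * (L ^ 2 + u s ^ 2)⁻¹ := by
        rw [integral_of_le h12.le, integral_of_le h12.le]
        refine integral_mono_of_nonneg
          (Filter.Eventually.of_forall fun s => indicator_nonneg (fun _ _ => by positivity) s)
          ?_ (Filter.Eventually.of_forall fun s => ?_)
        · refine (ContinuousOn.integrableOn_Icc ?_).mono_set Ioc_subset_Icc_self
          refine continuousOn_const.mul (ContinuousOn.inv₀ (by fun_prop) fun s _ => ?_)
          positivity
        · refine indicator_apply_le' (fun hs => ?_) (fun _ => by positivity)
          have hLs : L < ‖X s - Y s‖ := hs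
          have hus : |u s| ≤ ‖X s - Y s‖ := by
            simpa [he1] using abs_real_inner_le_norm e (X s - Y s)
          have husq : u s ^ 2 ≤ ‖X s - Y s‖ ^ 2 := sq_le_sq' (abs_le.1 hus).1 (abs_le.1 hus).2
          have hZ : 0 < ‖X s - Y s‖ := hL.trans hLs
          beta_reduce
          rw [← div_eq_mul_inv, inv_le_comm₀ (by positivity) (by positivity), inv_div]
          nlinarith
    _ ≤ 2 * (Real.pi / (3 * R / 4 * L)) := by
        rw [intervalIntegral.integral_const_mul]
        gcongr
        exact integral_inv_sq_add_sq_le h12.le (by positivity) hL hderiv hspeed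
    _ ≤ 16 / (R * L) := by
        rw [show 2 * (Real.pi / (3 * R / 4 * L)) = 8 / 3 * Real.pi / (R * L) by
          field_simp; ring]
        gcongr
        linarith [Real.pi_le_four]
end

section
/- Let A ≥ 3, B ≥ 0, and T > 0, and let u : [0,T] → ℝ be continuous with u(t) ≥ e for all t ∈ [0,T] and u(t) ≤ A·e^{B·t} + A·∫₀ᵗ u(s)·ln u(s) ds for all t ∈ [0,T]. Then there exists a constant C > 0, depending only on A and B (and not on T or u), such that u(t) ≤ exp(exp(C·(1 + t))) for all t ∈ [0,T]. -/
/-- A function with values at least `e` and `v' ≤ K v ln v` satisfies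
`ln ln v(t) ≤ ln ln v(0) + K t`. -/
theorem log_log_le_of_deriv_le_mul_log {K T : ℝ} {v v' : ℝ → ℝ}
    (hvc : ContinuousOn v (Set.Icc 0 T)) (hve : ∀ t ∈ Set.Icc 0 T, Real.exp 1 ≤ v t)
    (hvd : ∀ t ∈ Set.Ioo 0 T, HasDerivAt v (v' t) t)
    (hle : ∀ t ∈ Set.Ioo 0 T, v' t ≤ K * (v t * Real.log (v t))) {t : ℝ}
    (ht : t ∈ Set.Icc 0 T) :
    Real.log (Real.log (v t)) ≤ Real.log (Real.log (v 0)) + K * t := by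
  have hpos : ∀ s ∈ Set.Icc 0 T, 0 < v s := fun s hs => (Real.exp_pos 1).trans_le (hve s hs)
  have hlog : ∀ s ∈ Set.Icc 0 T, 0 < Real.log (v s) := fun s hs =>
    one_pos.trans_le ((Real.le_log_iff_exp_le (hpos s hs)).2 (hve s hs))
  have hderiv : ∀ s ∈ Set.Ioo 0 T,
      HasDerivAt (fun s => Real.log (Real.log (v s)) - K * s)
        (v' s / v s / Real.log (v s) - K * 1) s := fun s hs => by
    have hs' := Set.Ioo_subset_Icc_self hs
    exact (((hvd s hs).log (hpos s hs').ne').log (hlog s hs').ne').sub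
      ((hasDerivAt_id s).const_mul K)
  have hanti : AntitoneOn (fun s => Real.log (Real.log (v s)) - K * s) (Set.Icc 0 T) := by
    refine antitoneOn_of_deriv_nonpos (convex_Icc 0 T) ?_ ?_ ?_
    · exact ((hvc.log fun s hs => (hpos s hs).ne').log fun s hs => (hlog s hs).ne').sub
        (by fun_prop)
    · rw [interior_Icc]
      exact fun s hs => (hderiv s hs).differentiableAt.differentiableWithinAt
    · rw [interior_Icc]
      intro s hs
      have hs' := Set.Ioo_subset_Icc_self hs
      rw [(hderiv s hs).deriv, div_div, mul_one, sub_nonpos,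
        div_le_iff₀ (mul_pos (hpos s hs') (hlog s hs'))]
      exact hle s hs
  have h := hanti ⟨le_rfl, ht.1.trans ht.2⟩ ht ht.1
  simp only [mul_zero, sub_zero] at h
  linarith

/-- **Logarithmic Grönwall inequality.**
For `A ≥ 3` and `B ≥ 0` there is `C > 0`, depending only on `A` and `B` (not on `T` or `u`),
such that: whenever `T > 0` and `u : [0,T] → ℝ` is continuous with `u ≥ e` and
`u(t) ≤ A·e^{Bt} + A·∫₀ᵗ u·ln u` on `[0,T]`, one has
`u(t) ≤ exp(exp(C(1+t)))` on `[0,T]`. -/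
theorem stmt17 (A B : ℝ) (hA : 3 ≤ A) (hB : 0 ≤ B) :
    ∃ C > 0, ∀ T > (0 : ℝ), ∀ u : ℝ → ℝ,
      ContinuousOn u (Set.Icc 0 T) →
      (∀ t ∈ Set.Icc 0 T, Real.exp 1 ≤ u t) →
      (∀ t ∈ Set.Icc 0 T,
        u t ≤ A * Real.exp (B * t) + A * ∫ s in (0 : ℝ)..t, u s * Real.log (u s)) →
      ∀ t ∈ Set.Icc 0 T, u t ≤ Real.exp (Real.exp (C * (1 + t))) := by
  refine ⟨A + B, by linarith, fun T hT u huc hue hu t ht => ?_⟩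
  have hpos : ∀ s ∈ Set.Icc 0 T, 0 < u s := fun s hs => (Real.exp_pos 1).trans_le (hue s hs)
  have hlog : ∀ s ∈ Set.Icc 0 T, 1 ≤ Real.log (u s) := fun s hs =>
    (Real.le_log_iff_exp_le (hpos s hs)).2 (hue s hs)
  have hfc : ContinuousOn (fun s => u s * Real.log (u s)) (Set.Icc 0 T) :=
    huc.mul (huc.log fun s hs => (hpos s hs).ne')
  set v : ℝ → ℝ := fun t => A * Real.exp (B * t) + A * ∫ s in (0 : ℝ)..t, u s * Real.log (u s)
    with hv
  have hve : ∀ s ∈ Set.Icc 0 T, Real.exp 1 ≤ v s := fun s hs => (hue s hs).trans (hu s hs)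
  have hvc : ContinuousOn v (Set.Icc 0 T) := by
    refine ContinuousOn.add (by fun_prop) (continuousOn_const.mul ?_)
    have h := intervalIntegral.continuousOn_primitive_interval (μ := MeasureTheory.volume)
      (a := 0) (b := T) (f := fun s => u s * Real.log (u s))
      (by rw [Set.uIcc_of_le hT.le]; exact hfc.integrableOn_Icc)
    rwa [Set.uIcc_of_le hT.le] at h
  have hvd : ∀ s ∈ Set.Ioo 0 T,
      HasDerivAt v (A * (Real.exp (B * s) * (B * 1)) + A * (u s * Real.log (u s))) s := by
    intro s hs
    refine ((((hasDerivAt_id s).const_mul B).exp).const_mul A).add (HasDerivAt.const_mul A ?_)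
    refine intervalIntegral.integral_hasDerivAt_right ?_ ?_ ?_
    · refine ContinuousOn.intervalIntegrable (hfc.mono ?_)
      rw [Set.uIcc_of_le hs.1.le]
      exact Set.Icc_subset_Icc_right hs.2.le
    · exact (hfc.mono Set.Ioo_subset_Icc_self).stronglyMeasurableAtFilter isOpen_Ioo s hs
    · exact hfc.continuousAt (Icc_mem_nhds hs.1 hs.2)
  have hle : ∀ s ∈ Set.Ioo 0 T, A * (Real.exp (B * s) * (B * 1)) + A * (u s * Real.log (u s))
      ≤ (A + B) * (v s * Real.log (v s)) := by
    intro s hs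
    have hs' := Set.Ioo_subset_Icc_self hs
    have huv : u s ≤ v s := hu s hs'
    have hvpos : 0 < v s := (hpos s hs').trans_le huv
    have hloguv : Real.log (u s) ≤ Real.log (v s) := Real.log_le_log (hpos s hs') huv
    have hlogv : 1 ≤ Real.log (v s) := (hlog s hs').trans hloguv
    have hmul : u s * Real.log (u s) ≤ v s * Real.log (v s) :=
      mul_le_mul huv hloguv (zero_le_one.trans (hlog s hs')) hvpos.le
    have hint : 0 ≤ ∫ r in (0 : ℝ)..s, u r * Real.log (u r) :=
      intervalIntegral.integral_nonneg hs.1.le fun r hr =>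
        have hr' : r ∈ Set.Icc 0 T := ⟨hr.1, hr.2.trans hs.2.le⟩
        mul_nonneg (hpos r hr').le (zero_le_one.trans (hlog r hr'))
    have hexp : A * Real.exp (B * s) ≤ v s :=
      le_add_of_nonneg_right (mul_nonneg (by linarith) hint)
    calc A * (Real.exp (B * s) * (B * 1)) + A * (u s * Real.log (u s))
        = B * (A * Real.exp (B * s)) + A * (u s * Real.log (u s)) := by ring
      _ ≤ B * (v s * Real.log (v s)) + A * (v s * Real.log (v s)) := by
          have hexp' := hexp.trans (le_mul_of_one_le_right hvpos.le hlogv)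
          exact add_le_add (mul_le_mul_of_nonneg_left hexp' hB)
            (mul_le_mul_of_nonneg_left hmul (by linarith))
      _ = (A + B) * (v s * Real.log (v s)) := by ring
  have hv0 : v 0 = A := by simp [hv]
  have hvpos : 0 < v t := (Real.exp_pos 1).trans_le (hve t ht)
  have hlogv : 0 < Real.log (v t) :=
    one_pos.trans_le ((Real.le_log_iff_exp_le hvpos).2 (hve t ht))
  have hmain := log_log_le_of_deriv_le_mul_log hvc hve hvd hle ht
  have hlogA : 0 < Real.log A := Real.log_pos (by linarith)
  have hloglogA : Real.log (Real.log A) ≤ A :=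
    (Real.log_le_self hlogA.le).trans (Real.log_le_self (by linarith))
  rw [hv0] at hmain
  refine (hu t ht).trans ?_
  rw [← Real.log_le_iff_le_exp hvpos, ← Real.log_le_iff_le_exp hlogv]
  linarith
end

section
/- Let d ≥ 1, let Ω ⊆ ℝ^d be an open convex set, let x₀ ∈ Ω and v₀ ∈ ℝ^d with v₀ ≠ 0. Let N be an open neighborhood of (x₀, v₀) contained in Ω × (ℝ^d \ {0}) and let a : N → (0, ∞) satisfy, for every (x,v) ∈ N: x − a(x,v)·v ∈ ∂Ω and x − s·v ∈ Ω for all s ∈ [0, a(x,v)). If a is Fréchet differentiable at (x₀, v₀), then ∇_v a(x₀, v₀) + a(x₀, v₀)·∇_x a(x₀, v₀) = 0; equivalently, (1/2)·∇_x(a²) + ∇_v a = 0 at (x₀, v₀). -/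
/-- A ray issued from a point `x` of an open convex set leaves it at most once: if both `x - r • v`
and `x - s • v` are frontier points and `r > 0`, then `s ≤ r`. -/
theorem Convex.exit_time_le {E : Type*} [NormedAddCommGroup E] [NormedSpace ℝ E] {Ω : Set E}
    (hconv : Convex ℝ Ω) (hopen : IsOpen Ω) {x v : E} (hx : x ∈ Ω) {r s : ℝ} (hr : 0 < r)
    (hxr : x - r • v ∈ frontier Ω) (hxs : x - s • v ∈ frontier Ω) : s ≤ r := by
  by_contra! hlt
  have hs : 0 < s := hr.trans hlt
  have h := hconv.combo_interior_closure_mem_interior (hopen.interior_eq.symm ▸ hx) hxs.1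
    (a := 1 - r / s) (b := r / s) (sub_pos.2 ((div_lt_one hs).2 hlt)) (by positivity) (by ring)
  refine hxr.2 ?_
  convert h using 1
  rw [smul_sub, smul_smul, div_mul_cancel₀ _ hs.ne']
  module

/-- **Gradient identity for the backward exit time of straight-line characteristics.**
Let `Ω ⊆ ℝ^d` be open and convex, `x₀ ∈ Ω`, `v₀ ≠ 0`, and let `a` be defined on an open
neighborhood `N ⊆ Ω × (ℝ^d \ {0})` of `(x₀,v₀)` with values in `(0,∞)`, so that
`x − a(x,v)·v ∈ ∂Ω` and `x − s·v ∈ Ω` for `0 ≤ s < a(x,v)`. If `a` is Fréchet differentiable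
at `(x₀,v₀)`, then `∇_v a + a·∇_x a = 0` there; equivalently `(1/2)∇_x(a²) + ∇_v a = 0`. -/
theorem stmt18 (d : ℕ) (hd : 1 ≤ d) (Ω : Set (EuclideanSpace ℝ (Fin d)))
    (hopen : IsOpen Ω) (hconv : Convex ℝ Ω)
    (x₀ v₀ : EuclideanSpace ℝ (Fin d)) (hx₀ : x₀ ∈ Ω) (hv₀ : v₀ ≠ 0)
    (N : Set (EuclideanSpace ℝ (Fin d) × EuclideanSpace ℝ (Fin d)))
    (hNopen : IsOpen N) (hmem : (x₀, v₀) ∈ N)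
    (hNsub : N ⊆ Ω ×ˢ {v : EuclideanSpace ℝ (Fin d) | v ≠ 0})
    (a : EuclideanSpace ℝ (Fin d) × EuclideanSpace ℝ (Fin d) → ℝ)
    (hapos : ∀ p ∈ N, 0 < a p)
    (hexit : ∀ p ∈ N, p.1 - a p • p.2 ∈ frontier Ω)
    (hin : ∀ p ∈ N, ∀ s ∈ Set.Ico (0 : ℝ) (a p), p.1 - s • p.2 ∈ Ω)
    (hdiff : DifferentiableAt ℝ a (x₀, v₀)) :
    (∀ u : EuclideanSpace ℝ (Fin d),
      fderiv ℝ a (x₀, v₀) (0, u) + a (x₀, v₀) * fderiv ℝ a (x₀, v₀) (u, 0) = 0) ∧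
    (∀ u : EuclideanSpace ℝ (Fin d),
      (1 / 2) * fderiv ℝ (fun p => a p ^ 2) (x₀, v₀) (u, 0) +
        fderiv ℝ a (x₀, v₀) (0, u) = 0) := by
  set p₀ := (x₀, v₀) with hp₀
  have key : ∀ u : EuclideanSpace ℝ (Fin d),
      fderiv ℝ a p₀ (0, u) + a p₀ * fderiv ℝ a p₀ (u, 0) = 0 := by
    intro u
    -- Along this line the point `x - a p₀ • v` stays fixed, hence so does the exit time.
    let w : EuclideanSpace ℝ (Fin d) × EuclideanSpace ℝ (Fin d) := (a p₀ • u, u)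
    have hline : ∀ t : ℝ, (p₀ + t • w).1 - a p₀ • (p₀ + t • w).2 = p₀.1 - a p₀ • p₀.2 := by
      intro t
      simp only [w, hp₀, Prod.fst_add, Prod.snd_add, Prod.smul_fst, Prod.smul_snd]
      module
    have hN : ∀ᶠ t : ℝ in nhds 0, p₀ + t • w ∈ N := by
      have hc : Continuous fun t : ℝ => p₀ + t • w := by fun_prop
      exact hc.continuousAt.eventually_mem (hNopen.mem_nhds (by simpa using hmem))
    have hconst : (fun t : ℝ => a (p₀ + t • w)) =ᶠ[nhds 0] fun _ => a p₀ := by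
      filter_upwards [hN] with t ht
      have hfr : (p₀ + t • w).1 - a p₀ • (p₀ + t • w).2 ∈ frontier Ω :=
        hline t ▸ hexit p₀ hmem
      exact le_antisymm
        (hconv.exit_time_le hopen (hNsub ht).1 (hapos p₀ hmem) hfr (hexit _ ht))
        (hconv.exit_time_le hopen (hNsub ht).1 (hapos _ ht) (hexit _ ht) hfr)
    have hzero : fderiv ℝ a p₀ w = 0 := by
      rw [← hdiff.lineDeriv_eq_fderiv, lineDeriv, hconst.deriv_eq, deriv_const]
    have hw : w = (0, u) + a p₀ • (u, 0) := by simp [w]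
    rwa [hw, map_add, map_smul, smul_eq_mul] at hzero
  refine ⟨key, fun u => ?_⟩
  rw [fderiv_fun_pow 2 hdiff, ← key u]
  simp
  ring
end
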